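/- arXiv:2307.15844 — 2 statements merged into one kernel-verified Lean document; each statement's English description precedes it below -/
import Mathlib

section
/- Let X_1, …, X_m form a Markov chain on a tree G = (M, E). Then for every edge (i,j) ∈ E, I(X_{B(i←j)} ∧ X_{B(j←i)}) = I(X_i ∧ X_j); equivalently, X_{B(i←j)\{i}} −∘− X_i −∘− X_j −∘− X_{B(j←i)\{j}} is a Markov chain. -/
open Classical
open scoped BigOperators

noncomputable section

namespace MCT

variable {m : ℕ}

/-- Marginal pmf of the coordinates in `A`. -/
def marg (𝒳 : Fin m → Type) [∀ i, Fintype (𝒳 i)]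
    (p : (∀ i, 𝒳 i) → ℝ) (A : Finset (Fin m)) (y : (i : A) → 𝒳 i.1) : ℝ :=
  ∑ x : (i : Fin m) → 𝒳 i, if ∀ i : A, x i.1 = y i then p x else 0

/-- Shannon entropy (base 2) of the collection `X_A`. -/
def ent (𝒳 : Fin m → Type) [∀ i, Fintype (𝒳 i)]
    (p : (∀ i, 𝒳 i) → ℝ) (A : Finset (Fin m)) : ℝ :=
  -∑ y : (i : A) → 𝒳 i.1, marg 𝒳 p A y * Real.logb 2 (marg 𝒳 p A y)

/-- Mutual information I(X_A ∧ X_B). -/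
def mutI (𝒳 : Fin m → Type) [∀ i, Fintype (𝒳 i)]
    (p : (∀ i, 𝒳 i) → ℝ) (A B : Finset (Fin m)) : ℝ :=
  ent 𝒳 p A + ent 𝒳 p B - ent 𝒳 p (A ∪ B)

/-- Conditional mutual information I(X_A ∧ X_B | X_S). -/
def cmi (𝒳 : Fin m → Type) [∀ i, Fintype (𝒳 i)]
    (p : (∀ i, 𝒳 i) → ℝ) (A B S : Finset (Fin m)) : ℝ :=
  ent 𝒳 p (A ∪ S) + ent 𝒳 p (B ∪ S) - ent 𝒳 p (A ∪ B ∪ S) - ent 𝒳 p S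

/-- `side G i j` = B(i←j): vertices connected to `j` by a path containing edge (i,j),
equivalently the vertices on `i`'s side once edge (i,j) is removed. -/
def side {V : Type*} [Fintype V] (G : SimpleGraph V) (i j : V) : Finset V :=
  Finset.univ.filter fun k => (G.deleteEdges {s(i, j)}).Reachable k i

/-- Markov chain on a tree: for each edge (i,j), X_j ⊥ X_{B(i←j)\{i}} | X_i. -/
def IsMCT (𝒳 : Fin m → Type) [∀ i, Fintype (𝒳 i)] (G : SimpleGraph (Fin m))
    (p : (∀ i, 𝒳 i) → ℝ) : Prop :=
  ∀ i j : Fin m, G.Adj i j → cmi 𝒳 p {j} ((side G i j).erase i) {i} = 0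

/-- A partition of {1,…,m} into nonempty pairwise disjoint atoms covering everything. -/
def IsPartition (π : Finset (Finset (Fin m))) : Prop :=
  (∀ a ∈ π, a.Nonempty) ∧ ((π : Set (Finset (Fin m))).PairwiseDisjoint id) ∧
    π.sup id = Finset.univ

/-- I(π) = (1/(|π|−1))·[Σ_{a∈π} H(X_a) − H(X_M)]. -/
def cI (𝒳 : Fin m → Type) [∀ i, Fintype (𝒳 i)]
    (p : (∀ i, 𝒳 i) → ℝ) (π : Finset (Finset (Fin m))) : ℝ :=
  ((π.card : ℝ) - 1)⁻¹ * ((∑ a ∈ π, ent 𝒳 p a) - ent 𝒳 p Finset.univ)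

/-- Shared information: minimum of I(π) over partitions with at least two atoms. -/
def SI (𝒳 : Fin m → Type) [∀ i, Fintype (𝒳 i)] (p : (∀ i, 𝒳 i) → ℝ) : ℝ :=
  sInf {r | ∃ π : Finset (Finset (Fin m)), IsPartition π ∧ 2 ≤ π.card ∧ r = cI 𝒳 p π}


section Entropy

variable {ι : Type*} {α : ι → Type*}

/-- Two configurations agree on the coordinates in `A`. -/
def AgreeOn (A : Finset ι) (x y : ∀ i, α i) : Prop := ∀ i ∈ A, x i = y i

lemma AgreeOn.symm {A : Finset ι} {x y : ∀ i, α i} (h : AgreeOn A x y) : AgreeOn A y x :=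
  fun i hi => (h i hi).symm

lemma AgreeOn.trans {A : Finset ι} {x y z : ∀ i, α i} (h : AgreeOn A x y) (h' : AgreeOn A y z) :
    AgreeOn A x z :=
  fun i hi => (h i hi).trans (h' i hi)

variable [Fintype (∀ i, α i)]

/-- The probability that a configuration agrees with `x` on `A`. -/
def cylinder (p : (∀ i, α i) → ℝ) (A : Finset ι) (x : ∀ i, α i) : ℝ :=
  ∑ z, if AgreeOn A z x then p z else 0

variable {p : (∀ i, α i) → ℝ}

lemma cylinder_congr {A : Finset ι} {x y : ∀ i, α i} (h : AgreeOn A x y) :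
    cylinder p A x = cylinder p A y :=
  Finset.sum_congr rfl fun _ _ =>
    if_congr ⟨fun hz => hz.trans h, fun hz => hz.trans h.symm⟩ rfl rfl

lemma cylinder_nonneg (hp : ∀ x, 0 ≤ p x) (A : Finset ι) (x : ∀ i, α i) :
    0 ≤ cylinder p A x :=
  Finset.sum_nonneg fun z _ => by split_ifs <;> simp [hp]

lemma le_cylinder (hp : ∀ x, 0 ≤ p x) (A : Finset ι) (x : ∀ i, α i) :
    p x ≤ cylinder p A x := by
  have := Finset.single_le_sum (f := fun z => if AgreeOn A z x then p z else 0)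
    (fun z _ => by split_ifs <;> simp [hp]) (Finset.mem_univ x)
  simpa [AgreeOn, cylinder] using this

variable [DecidableEq ι]

/-- Given the values on `U` and `V`, the conditional weights on `U ∪ V` sum to at most one, and
vanish when the values are incompatible. -/
lemma sum_div_cylinder_union_le (hp : ∀ x, 0 ≤ p x) (U V : Finset ι) (y z : ∀ i, α i) :
    (∑ x, if AgreeOn U y x ∧ AgreeOn V z x then p x / cylinder p (U ∪ V) x else 0) ≤
      if AgreeOn (U ∩ V) z y then 1 else 0 := by
  by_cases hex : ∃ x, AgreeOn U y x ∧ AgreeOn V z x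
  · obtain ⟨x₀, hU, hV⟩ := hex
    have hyz : AgreeOn (U ∩ V) z y := fun i hi => by
      rw [Finset.mem_inter] at hi
      rw [hV i hi.2, hU i hi.1]
    rw [if_pos hyz]
    calc _ ≤ ∑ x, (if AgreeOn (U ∪ V) x x₀ then p x else 0) / cylinder p (U ∪ V) x₀ := by
          refine Finset.sum_le_sum fun x _ => ?_
          by_cases hx : AgreeOn U y x ∧ AgreeOn V z x
          · have h : AgreeOn (U ∪ V) x x₀ := fun i hi => by
              rcases Finset.mem_union.1 hi with hi | hi
              · rw [← hx.1 i hi, hU i hi]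
              · rw [← hx.2 i hi, hV i hi]
            rw [if_pos hx, if_pos h, cylinder_congr h]
          · rw [if_neg hx]
            refine div_nonneg ?_ (cylinder_nonneg hp _ _)
            split_ifs <;> simp [hp]
      _ = cylinder p (U ∪ V) x₀ / cylinder p (U ∪ V) x₀ := by
          rw [← Finset.sum_div, cylinder]
      _ ≤ 1 := div_self_le_one _
  · push Not at hex
    rw [Finset.sum_eq_zero fun x _ => if_neg fun h => hex x h.1 h.2]
    split_ifs <;> norm_num

lemma sum_cylinder_ratio_le (hp : ∀ x, 0 ≤ p x) (U V : Finset ι) :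
    ∑ x, p x * (cylinder p U x * cylinder p V x /
      (cylinder p (U ∪ V) x * cylinder p (U ∩ V) x)) ≤ ∑ x, p x := by
  have expand : ∀ x, p x * (cylinder p U x * cylinder p V x /
      (cylinder p (U ∪ V) x * cylinder p (U ∩ V) x)) =
      ∑ y, ∑ z, p y / cylinder p (U ∩ V) y * p z *
        (if AgreeOn U y x ∧ AgreeOn V z x then p x / cylinder p (U ∪ V) x else 0) := by
    intro x
    have : p x * (cylinder p U x * cylinder p V x /
      (cylinder p (U ∪ V) x * cylinder p (U ∩ V) x)) =
      cylinder p U x * cylinder p V x * (p x / cylinder p (U ∪ V) x / cylinder p (U ∩ V) x) := by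
      rw [div_div]; ring
    rw [this]
    nth_rewrite 1 [cylinder]
    nth_rewrite 1 [cylinder]
    rw [Finset.sum_mul_sum, Finset.sum_mul]
    refine Finset.sum_congr rfl fun y _ => ?_
    rw [Finset.sum_mul]
    refine Finset.sum_congr rfl fun z _ => ?_
    by_cases hU : AgreeOn U y x
    · by_cases hV : AgreeOn V z x
      · have h : AgreeOn (U ∩ V) y x := fun i hi => hU i (Finset.mem_inter.1 hi).1
        rw [if_pos hU, if_pos hV, if_pos ⟨hU, hV⟩, cylinder_congr h]
        ring
      · simp [hV]
    · simp [hU]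
  simp_rw [expand]
  rw [Finset.sum_comm]
  refine Finset.sum_le_sum fun y _ => ?_
  rw [Finset.sum_comm]
  calc _ ≤ ∑ z, p y / cylinder p (U ∩ V) y * (if AgreeOn (U ∩ V) z y then p z else 0) := by
        refine Finset.sum_le_sum fun z _ => ?_
        rw [← Finset.mul_sum]
        calc _ ≤ p y / cylinder p (U ∩ V) y * p z * (if AgreeOn (U ∩ V) z y then 1 else 0) :=
              mul_le_mul_of_nonneg_left (sum_div_cylinder_union_le hp U V y z)
                (mul_nonneg (div_nonneg (hp y) (cylinder_nonneg hp _ _)) (hp z))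
          _ = _ := by split_ifs <;> simp
    _ = p y * (cylinder p (U ∩ V) y / cylinder p (U ∩ V) y) := by
        rw [← Finset.mul_sum, ← cylinder]; ring
    _ ≤ p y := mul_le_of_le_one_right (hp y) (div_self_le_one _)

lemma sum_mul_log_cylinder_le (hp : ∀ x, 0 ≤ p x) (U V : Finset ι) :
    ∑ x, p x * Real.log (cylinder p U x) + ∑ x, p x * Real.log (cylinder p V x) ≤
      ∑ x, p x * Real.log (cylinder p (U ∪ V) x) +
        ∑ x, p x * Real.log (cylinder p (U ∩ V) x) := by
  have key : ∀ x, p x * Real.log (cylinder p U x) + p x * Real.log (cylinder p V x) ≤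
      p x * Real.log (cylinder p (U ∪ V) x) + p x * Real.log (cylinder p (U ∩ V) x) +
      (p x * (cylinder p U x * cylinder p V x /
        (cylinder p (U ∪ V) x * cylinder p (U ∩ V) x)) - p x) := by
    intro x
    rcases (hp x).eq_or_lt with h0 | h0
    · simp [← h0]
    have hpos : ∀ A, 0 < cylinder p A x := fun A => h0.trans_le (le_cylinder hp A x)
    have hlog := Real.log_le_sub_one_of_pos (div_pos (mul_pos (hpos U) (hpos V))
      (mul_pos (hpos (U ∪ V)) (hpos (U ∩ V))))
    rw [Real.log_div (mul_pos (hpos _) (hpos _)).ne' (mul_pos (hpos _) (hpos _)).ne',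
      Real.log_mul (hpos _).ne' (hpos _).ne', Real.log_mul (hpos _).ne' (hpos _).ne'] at hlog
    have := mul_le_mul_of_nonneg_left hlog h0.le
    linarith
  have hsum := Finset.sum_le_sum fun x (_ : x ∈ Finset.univ) => key x
  simp only [Finset.sum_add_distrib, Finset.sum_sub_distrib] at hsum
  linarith [sum_cylinder_ratio_le hp U V]

end Entropy

lemma ent_eq_sum_cylinder (𝒳 : Fin m → Type) [∀ i, Fintype (𝒳 i)]
    (p : (∀ i, 𝒳 i) → ℝ) (A : Finset (Fin m)) :
    ent 𝒳 p A = -(∑ x, p x * Real.log (cylinder p A x)) / Real.log 2 := by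
  have hmarg : ∀ x : ∀ i, 𝒳 i, marg 𝒳 p A (fun i => x i.1) = cylinder p A x := fun x =>
    Finset.sum_congr rfl fun z _ => if_congr (by simp [AgreeOn]) rfl rfl
  have hswap : ∑ y : (i : A) → 𝒳 i.1, marg 𝒳 p A y * Real.logb 2 (marg 𝒳 p A y) =
      ∑ x, p x * Real.logb 2 (cylinder p A x) := by
    calc _ = ∑ y : (i : A) → 𝒳 i.1, ∑ x : ∀ i, 𝒳 i,
          if y = (fun i : A => x i.1) then p x * Real.logb 2 (marg 𝒳 p A y) else 0 := by
          refine Finset.sum_congr rfl fun y _ => ?_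
          nth_rewrite 1 [marg]
          rw [Finset.sum_mul]
          refine Finset.sum_congr rfl fun x _ => ?_
          rw [ite_mul, zero_mul]
          exact if_congr (by rw [funext_iff]; exact forall_congr' fun _ => eq_comm) rfl rfl
      _ = _ := by
          rw [Finset.sum_comm]
          refine Finset.sum_congr rfl fun x _ => ?_
          rw [Finset.sum_ite_eq' Finset.univ, if_pos (Finset.mem_univ _), hmarg]
  rw [ent, hswap, neg_div, Finset.sum_div]
  simp only [Real.logb, mul_div_assoc]

/-- Shannon entropy is submodular. -/
lemma ent_union_add_ent_inter_le (𝒳 : Fin m → Type) [∀ i, Fintype (𝒳 i)]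
    {p : (∀ i, 𝒳 i) → ℝ} (hp : ∀ x, 0 ≤ p x) (U V : Finset (Fin m)) :
    ent 𝒳 p (U ∪ V) + ent 𝒳 p (U ∩ V) ≤ ent 𝒳 p U + ent 𝒳 p V := by
  simp only [ent_eq_sum_cylinder, ← add_div]
  refine div_le_div_of_nonneg_right ?_ (Real.log_nonneg one_le_two)
  linarith [sum_mul_log_cylinder_le hp U V]

/-- The entropy increment of a new coordinate decreases as the conditioning set grows. -/
lemma ent_insert_sub_antitone (𝒳 : Fin m → Type) [∀ i, Fintype (𝒳 i)]
    {p : (∀ i, 𝒳 i) → ℝ} (hp : ∀ x, 0 ≤ p x) {S T : Finset (Fin m)} (hST : S ⊆ T)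
    {v : Fin m} (hv : v ∉ T) :
    ent 𝒳 p (insert v T) - ent 𝒳 p T ≤ ent 𝒳 p (insert v S) - ent 𝒳 p S := by
  have h := ent_union_add_ent_inter_le 𝒳 hp (insert v S) T
  rw [Finset.insert_union, Finset.union_eq_right.2 hST, Finset.insert_inter_of_notMem hv,
    Finset.inter_eq_left.2 hST] at h
  linarith

section Graph

variable {V : Type*} [Fintype V] {G : SimpleGraph V}

lemma mem_side {i j k : V} : k ∈ side G i j ↔ (G.deleteEdges {s(i, j)}).Reachable k i := by
  simp [side]

lemma mem_side_self (i j : V) : i ∈ side G i j := mem_side.2 .rfl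

lemma disjoint_side (hG : G.IsAcyclic) {i j : V} (hij : G.Adj i j) :
    Disjoint (side G i j) (side G j i) := by
  rw [Finset.disjoint_left]
  intro k hi hj
  rw [mem_side] at hi hj
  rw [Sym2.eq_swap] at hj
  have hb := SimpleGraph.isAcyclic_iff_forall_adj_isBridge.1 hG hij
  rw [SimpleGraph.isBridge_iff] at hb
  exact hb (hi.symm.trans hj)

lemma connected_induce_side (i j : V) : (G.induce (side G i j : Set V)).Connected := by
  have h : ((G.deleteEdges {s(i, j)}).induce
      ((G.deleteEdges {s(i, j)}).connectedComponentMk i).supp).Connected :=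
    ((G.deleteEdges {s(i, j)}).connectedComponentMk i).connected_toSimpleGraph
  have hs : (side G i j : Set V) = ((G.deleteEdges {s(i, j)}).connectedComponentMk i).supp := by
    ext k
    simp [side]
  rw [hs]
  exact h.mono fun a b hab => G.deleteEdges_le {s(i, j)} hab

/-- A connected vertex set containing `u` but not `v` lies on the `u` side of the edge `uv`. -/
lemma subset_side_of_connected {T : Finset V} (hT : (G.induce (T : Set V)).Connected) {u v : V}
    (hu : u ∈ T) (hv : v ∉ T) : T ⊆ side G u v := by
  intro k hk
  rw [mem_side]
  let f : G.induce (T : Set V) →g G.deleteEdges {s(u, v)} :=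
    { toFun := Subtype.val
      map_rel' := by
        intro a b hab
        rw [SimpleGraph.deleteEdges_adj]
        refine ⟨hab, fun h => ?_⟩
        have hmem : v ∈ s(a.1, b.1) := by
          rw [Set.mem_singleton_iff.1 h]
          exact Sym2.mem_mk_right u v
        rcases Sym2.mem_iff.1 hmem with rfl | rfl
        · exact hv a.2
        · exact hv b.2 }
  exact (hT.preconnected ⟨k, hk⟩ ⟨u, hu⟩).map f

/-- A proper subset of `side G j i` containing `j` has a neighbour in `side G j i`. -/
lemma exists_adj_of_ssubset_side {i j : V} {A : Finset V} (hj : j ∈ A) (hA : A ⊂ side G j i) :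
    ∃ u ∈ A, ∃ v ∈ side G j i, v ∉ A ∧ G.Adj u v := by
  obtain ⟨w, hw, hwA⟩ := Finset.exists_of_ssubset hA
  obtain ⟨q⟩ := ((connected_induce_side (G := G) j i).preconnected
    ⟨j, mem_side_self j i⟩ ⟨w, hw⟩)
  obtain ⟨d, -, hd, hd'⟩ := q.exists_boundary_dart {x | x.1 ∈ A} hj hwA
  exact ⟨d.fst.1, hd, d.snd.1, d.snd.2, hd', d.adj⟩

end Graph

/-- In a Markov chain on a tree, adding a neighbour `v` of `u ∈ T` to a connected set `T`
increases the entropy by the conditional entropy of `X_v` given `X_u`. -/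
lemma IsMCT.ent_insert_sub {𝒳 : Fin m → Type} [∀ i, Fintype (𝒳 i)] {G : SimpleGraph (Fin m)}
    {p : (∀ i, 𝒳 i) → ℝ} (hMCT : IsMCT 𝒳 G p) (hp : ∀ x, 0 ≤ p x) (hG : G.IsAcyclic)
    {T : Finset (Fin m)} (hT : (G.induce (T : Set (Fin m))).Connected) {u v : Fin m}
    (huv : G.Adj u v) (hu : u ∈ T) (hv : v ∉ T) :
    ent 𝒳 p (insert v T) - ent 𝒳 p T = ent 𝒳 p {v, u} - ent 𝒳 p {u} := by
  have hvs : v ∉ side G u v := fun h =>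
    Finset.disjoint_left.1 (disjoint_side hG huv) h (mem_side_self v u)
  have h₁ := ent_insert_sub_antitone 𝒳 hp (Finset.singleton_subset_iff.2 hu) hv
  have h₂ := ent_insert_sub_antitone 𝒳 hp (subset_side_of_connected hT hu hv) hvs
  have h₃ := hMCT u v huv
  have he : (side G u v).erase u ∪ {u} = side G u v := by
    rw [Finset.union_comm, ← Finset.insert_eq, Finset.insert_erase (mem_side_self u v)]
  rw [cmi, Finset.union_assoc, he, ← Finset.insert_eq, ← Finset.insert_eq] at h₃
  linarith

/-- Adding `side G i j` to the opposite side `side G j i` increases the entropy as much as adding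
it to `{j}`. -/
lemma IsMCT.ent_union_side_sub {𝒳 : Fin m → Type} [∀ i, Fintype (𝒳 i)]
    {G : SimpleGraph (Fin m)} {p : (∀ i, 𝒳 i) → ℝ} (hMCT : IsMCT 𝒳 G p) (hp : ∀ x, 0 ≤ p x)
    (hG : G.IsAcyclic) {i j : Fin m} (hij : G.Adj i j) :
    ent 𝒳 p (side G j i ∪ side G i j) - ent 𝒳 p (side G j i) =
      ent 𝒳 p (insert j (side G i j)) - ent 𝒳 p {j} := by
  let good : Finset (Fin m) → Prop := fun A =>
    j ∈ A ∧ A ⊆ side G j i ∧ (G.induce (A : Set (Fin m))).Connected ∧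
      ent 𝒳 p (A ∪ side G i j) - ent 𝒳 p A = ent 𝒳 p (insert j (side G i j)) - ent 𝒳 p {j}
  have hne : (Finset.univ.filter good).Nonempty := by
    refine ⟨{j}, Finset.mem_filter.2 ⟨Finset.mem_univ _, Finset.mem_singleton_self j,
      Finset.singleton_subset_iff.2 (mem_side_self j i), ?_, by rw [← Finset.insert_eq]⟩⟩
    rw [Finset.coe_singleton]
    exact SimpleGraph.Connected.mk (by rintro ⟨a, rfl⟩ ⟨b, rfl⟩; rfl)
  obtain ⟨A, hA, hmax⟩ := Finset.exists_max_image _ Finset.card hne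
  obtain ⟨hjA, hAs, hAc, hAe⟩ := (Finset.mem_filter.1 hA).2
  rcases hAs.eq_or_ssubset with rfl | hss
  · exact hAe
  exfalso
  obtain ⟨u, hu, v, hv, hvA, huv⟩ := exists_adj_of_ssubset_side hjA hss
  have hvi : v ∉ side G i j := fun h => Finset.disjoint_left.1 (disjoint_side hG hij) h hv
  have hTc : (G.induce ((A ∪ side G i j : Finset (Fin m)) : Set (Fin m))).Connected := by
    rw [Finset.coe_union]
    exact SimpleGraph.connected_induce_union hAc.preconnected
      (connected_induce_side i j).preconnected hjA (mem_side_self i j) hij.symm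
  have hAc' : (G.induce ((insert v A : Finset (Fin m)) : Set (Fin m))).Connected := by
    rw [Finset.insert_eq, Finset.union_comm, Finset.coe_union, Finset.coe_singleton]
    exact SimpleGraph.connected_induce_union hAc.preconnected
      (by rintro ⟨a, rfl⟩ ⟨b, rfl⟩; rfl) hu (Set.mem_singleton v) huv
  have h₁ := hMCT.ent_insert_sub hp hG hAc huv hu hvA
  have h₂ := hMCT.ent_insert_sub hp hG hTc huv (Finset.mem_union_left _ hu)
    (by simp [hvA, hvi])
  have hgood : good (insert v A) := by
    refine ⟨Finset.mem_insert_of_mem hjA, Finset.insert_subset hv hAs, hAc', ?_⟩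
    rw [Finset.insert_union]
    linarith
  have hle := hmax _ (Finset.mem_filter.2 ⟨Finset.mem_univ _, hgood⟩)
  rw [Finset.card_insert_of_notMem hvA] at hle
  omega

/-- For every edge (i,j) of an MCT, I(X_B(i←j) ∧ X_B(j←i)) = I(X_i ∧ X_j);
equivalently X_{B(i←j)∖{i}} −∘− X_i −∘− X_j −∘− X_{B(j←i)∖{j}} is a Markov chain,
i.e. I(X_j ∧ X_{B(i←j)∖{i}} | X_i) = 0 and I(X_{B(j←i)∖{j}} ∧ X_{B(i←j)} | X_j) = 0. -/
theorem edge_agglomeration_mutualInformation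
    {m : ℕ} (hm : 2 ≤ m) (𝒳 : Fin m → Type) [∀ i, Fintype (𝒳 i)]
    (p : (∀ i, 𝒳 i) → ℝ) (hp0 : ∀ x, 0 ≤ p x) (hp1 : ∑ x, p x = 1)
    (G : SimpleGraph (Fin m)) (hG : G.IsTree) (hMCT : IsMCT 𝒳 G p) :
    ∀ i j : Fin m, G.Adj i j →
      mutI 𝒳 p (side G i j) (side G j i) = mutI 𝒳 p {i} {j} ∧
      cmi 𝒳 p {j} ((side G i j).erase i) {i} = 0 ∧
      cmi 𝒳 p ((side G j i).erase j) (side G i j) {j} = 0 := by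
  intro i j hij
  have hside := hMCT.ent_union_side_sub hp0 hG.isAcyclic hij
  have hj : j ∉ side G i j := fun h =>
    Finset.disjoint_left.1 (disjoint_side hG.isAcyclic hij) h (mem_side_self j i)
  have hstep := hMCT.ent_insert_sub hp0 hG.isAcyclic (connected_induce_side i j) hij
    (mem_side_self i j) hj
  have he : (side G j i).erase j ∪ {j} = side G j i := by
    rw [Finset.union_comm, ← Finset.insert_eq, Finset.insert_erase (mem_side_self j i)]
  refine ⟨?_, hMCT i j hij, ?_⟩
  · rw [mutI, mutI, Finset.union_comm (side G i j), Finset.union_comm {i}, ← Finset.insert_eq]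
    linarith
  · rw [cmi, Finset.union_right_comm, he, Finset.union_comm (side G i j) {j},
      ← Finset.insert_eq]
    linarith

end MCT
end
end

section
/- Random variables X_1, …, X_m assigned to the vertices of a tree G = (M, E) form a Markov chain on the tree G if and only if they have the global Markov property: for every three disjoint nonempty subsets A, B, S of M such that S separates A and B in G, the conditional independence X_A −∘− X_S −∘− X_B holds, i.e., I(X_A ∧ X_B | X_S) = 0. In particular, this equivalence holds without assuming that the joint pmf P_{X_M} is strictly positive. -/
open Classical
open scoped BigOperators

noncomputable section

namespace MCT

variable {m : ℕ}

/-- Global Markov property: for all disjoint nonempty A, B, S with S separating A and B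
(every walk from A to B meets S), X_A ⊥ X_B | X_S. -/
def GlobalMarkov {m : ℕ} (𝒳 : Fin m → Type) [∀ i, Fintype (𝒳 i)] (G : SimpleGraph (Fin m))
    (p : (∀ i, 𝒳 i) → ℝ) : Prop :=
  ∀ A B S : Finset (Fin m), A.Nonempty → B.Nonempty → S.Nonempty →
    Disjoint A B → Disjoint A S → Disjoint B S →
    (∀ a ∈ A, ∀ b ∈ B, ∀ w : G.Walk a b, ∃ s ∈ S, s ∈ w.support) →
    cmi 𝒳 p A B S = 0

section Entropy

variable (𝒳 : Fin m → Type) [∀ i, Fintype (𝒳 i)] (p : (∀ i, 𝒳 i) → ℝ)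

/-- The probability that `X_A` agrees with the `A`-coordinates of `x`. -/
def cylProb (A : Finset (Fin m)) (x : ∀ i, 𝒳 i) : ℝ :=
  ∑ x' : ∀ i, 𝒳 i, if ∀ i ∈ A, x' i = x i then p x' else 0

lemma marg_restrict (A : Finset (Fin m)) (x : ∀ i, 𝒳 i) :
    marg 𝒳 p A (fun i => x i) = cylProb 𝒳 p A x := by
  simp [marg, cylProb]

lemma ent_eq_neg_sum_cylProb (A : Finset (Fin m)) :
    ent 𝒳 p A = -∑ x, p x * Real.logb 2 (cylProb 𝒳 p A x) := by
  have h : ∀ y : (i : A) → 𝒳 i.1, marg 𝒳 p A y * Real.logb 2 (marg 𝒳 p A y) =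
      ∑ x : (i : Fin m) → 𝒳 i,
        if y = (fun i : A => x i) then p x * Real.logb 2 (marg 𝒳 p A y) else 0 := by
    intro y
    conv_lhs => enter [1]; unfold marg
    rw [Finset.sum_mul]
    refine Finset.sum_congr rfl fun x _ => ?_
    by_cases hxy : y = fun i : A => x i
    · simp [hxy]
    · have : ¬ ∀ i : A, x i.1 = y i := fun h => hxy (funext fun i => (h i).symm)
      rw [if_neg this, if_neg hxy, zero_mul]
  rw [ent, Finset.sum_congr rfl fun y _ => h y, Finset.sum_comm]
  simp [marg_restrict]

variable {𝒳 p}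

lemma cylProb_nonneg (hp0 : ∀ x, 0 ≤ p x) (A : Finset (Fin m)) (x : ∀ i, 𝒳 i) :
    0 ≤ cylProb 𝒳 p A x :=
  Finset.sum_nonneg fun x' _ => by split_ifs <;> simp [hp0]

lemma le_cylProb (hp0 : ∀ x, 0 ≤ p x) (A : Finset (Fin m)) (x : ∀ i, 𝒳 i) :
    p x ≤ cylProb 𝒳 p A x := by
  have := Finset.single_le_sum
    (f := fun x' : ∀ i, 𝒳 i => if ∀ i ∈ A, x' i = x i then p x' else 0)
    (fun x' _ => by split_ifs <;> simp [hp0]) (Finset.mem_univ x)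
  simpa [cylProb] using this

lemma cylProb_congr {A : Finset (Fin m)} {x y : ∀ i, 𝒳 i} (h : ∀ i ∈ A, x i = y i) :
    cylProb 𝒳 p A x = cylProb 𝒳 p A y := by
  refine Finset.sum_congr rfl fun x' _ => ?_
  have : (∀ i ∈ A, x' i = x i) ↔ ∀ i ∈ A, x' i = y i :=
    forall₂_congr fun i hi => by rw [h i hi]
  simp only [this]

lemma sum_div_cylProb_le_one {X Y : Finset (Fin m)} (x' x'' : ∀ i, 𝒳 i) :
    ∑ x, (if (∀ i ∈ X, x' i = x i) ∧ ∀ i ∈ Y, x'' i = x i then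
      p x / cylProb 𝒳 p (X ∪ Y) x else 0) ≤ 1 := by
  by_cases hz : ∃ z : ∀ i, 𝒳 i, (∀ i ∈ X, x' i = z i) ∧ ∀ i ∈ Y, x'' i = z i
  · obtain ⟨z, hzX, hzY⟩ := hz
    have : ∀ x : ∀ i, 𝒳 i, (if (∀ i ∈ X, x' i = x i) ∧ ∀ i ∈ Y, x'' i = x i then
        p x / cylProb 𝒳 p (X ∪ Y) x else 0) =
        (if ∀ i ∈ X ∪ Y, x i = z i then p x else 0) / cylProb 𝒳 p (X ∪ Y) z := by
      intro x
      have hiff : ((∀ i ∈ X, x' i = x i) ∧ ∀ i ∈ Y, x'' i = x i) ↔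
          ∀ i ∈ X ∪ Y, x i = z i := by
        constructor
        · rintro ⟨hX, hY⟩ i hi
          rcases Finset.mem_union.1 hi with hi | hi
          · rw [← hX i hi, hzX i hi]
          · rw [← hY i hi, hzY i hi]
        · intro h
          exact ⟨fun i hi => by rw [h i (Finset.mem_union_left _ hi), hzX i hi],
            fun i hi => by rw [h i (Finset.mem_union_right _ hi), hzY i hi]⟩
      by_cases h : ∀ i ∈ X ∪ Y, x i = z i
      · rw [if_pos (hiff.2 h), if_pos h, cylProb_congr h]
      · rw [if_neg (fun h' => h (hiff.1 h')), if_neg h, zero_div]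
    rw [Finset.sum_congr rfl fun x _ => this x, ← Finset.sum_div]
    exact div_self_le_one (cylProb 𝒳 p (X ∪ Y) z)
  · rw [Finset.sum_eq_zero fun x _ => if_neg fun h => hz ⟨x, h⟩]
    exact zero_le_one

lemma sum_mul_cylProb_div_le_one (hp0 : ∀ x, 0 ≤ p x) (hp1 : ∑ x, p x = 1)
    (X Y : Finset (Fin m)) :
    ∑ x, p x * (cylProb 𝒳 p X x * cylProb 𝒳 p Y x /
      (cylProb 𝒳 p (X ∪ Y) x * cylProb 𝒳 p (X ∩ Y) x)) ≤ 1 := by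
  calc
    _ = ∑ x, ∑ x'', ∑ x', (p x'' * ((if ∀ i ∈ X ∩ Y, x' i = x'' i then p x' else 0) /
          cylProb 𝒳 p (X ∩ Y) x'')) *
          (if (∀ i ∈ X, x' i = x i) ∧ ∀ i ∈ Y, x'' i = x i then
            p x / cylProb 𝒳 p (X ∪ Y) x else 0) := by
      refine Finset.sum_congr rfl fun x _ => ?_
      rw [show p x * (cylProb 𝒳 p X x * cylProb 𝒳 p Y x /
          (cylProb 𝒳 p (X ∪ Y) x * cylProb 𝒳 p (X ∩ Y) x)) =
          cylProb 𝒳 p Y x * cylProb 𝒳 p X x *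
          (p x / (cylProb 𝒳 p (X ∪ Y) x * cylProb 𝒳 p (X ∩ Y) x)) by ring]
      conv_lhs => enter [1, 1]; unfold cylProb
      conv_lhs => enter [1, 2]; unfold cylProb
      rw [Finset.sum_mul_sum, Finset.sum_mul]
      refine Finset.sum_congr rfl fun x'' _ => ?_
      rw [Finset.sum_mul]
      refine Finset.sum_congr rfl fun x' _ => ?_
      by_cases hX : ∀ i ∈ X, x' i = x i
      · by_cases hY : ∀ i ∈ Y, x'' i = x i
        · have hI : ∀ i ∈ X ∩ Y, x' i = x'' i := fun i hi => by
            rw [hX i (Finset.mem_inter.1 hi).1, hY i (Finset.mem_inter.1 hi).2]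
          have hI' : cylProb 𝒳 p (X ∩ Y) x'' = cylProb 𝒳 p (X ∩ Y) x :=
            cylProb_congr fun i hi => hY i (Finset.mem_inter.1 hi).2
          rw [if_pos hX, if_pos hY, if_pos hI, if_pos ⟨hX, hY⟩, hI',
            mul_comm (cylProb 𝒳 p (X ∪ Y) x), ← div_div]
          ring
        · rw [if_neg hY, if_neg (c := _ ∧ _) (fun h => hY h.2)]
          ring
      · rw [if_neg hX, if_neg (c := _ ∧ _) (fun h => hX h.1)]
        ring
    _ = ∑ x'', ∑ x', (p x'' * ((if ∀ i ∈ X ∩ Y, x' i = x'' i then p x' else 0) /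
          cylProb 𝒳 p (X ∩ Y) x'')) *
          ∑ x, (if (∀ i ∈ X, x' i = x i) ∧ ∀ i ∈ Y, x'' i = x i then
            p x / cylProb 𝒳 p (X ∪ Y) x else 0) := by
      rw [Finset.sum_comm]
      refine Finset.sum_congr rfl fun x'' _ => ?_
      rw [Finset.sum_comm]
      exact Finset.sum_congr rfl fun x' _ => (Finset.mul_sum _ _ _).symm
    _ ≤ ∑ x'', ∑ x', (p x'' * ((if ∀ i ∈ X ∩ Y, x' i = x'' i then p x' else 0) /
          cylProb 𝒳 p (X ∩ Y) x'')) := by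
      refine Finset.sum_le_sum fun x'' _ => Finset.sum_le_sum fun x' _ => ?_
      refine mul_le_of_le_one_right (mul_nonneg (hp0 _) (div_nonneg ?_ (cylProb_nonneg hp0 _ _)))
        (sum_div_cylProb_le_one x' x'')
      split_ifs <;> simp [hp0]
    _ = ∑ x'', p x'' * (cylProb 𝒳 p (X ∩ Y) x'' / cylProb 𝒳 p (X ∩ Y) x'') := by
      refine Finset.sum_congr rfl fun x'' _ => ?_
      rw [← Finset.mul_sum, ← Finset.sum_div]
      rfl
    _ ≤ ∑ x'', p x'' :=
      Finset.sum_le_sum fun x'' _ => mul_le_of_le_one_right (hp0 _) (div_self_le_one _)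
    _ = 1 := hp1

lemma ent_submodular (hp0 : ∀ x, 0 ≤ p x) (hp1 : ∑ x, p x = 1) (X Y : Finset (Fin m)) :
    ent 𝒳 p (X ∪ Y) + ent 𝒳 p (X ∩ Y) ≤ ent 𝒳 p X + ent 𝒳 p Y := by
  have hlog : (0 : ℝ) < Real.log 2 := Real.log_pos one_lt_two
  have hle : ∑ x, p x * (Real.log (cylProb 𝒳 p X x) + Real.log (cylProb 𝒳 p Y x) -
      Real.log (cylProb 𝒳 p (X ∪ Y) x) - Real.log (cylProb 𝒳 p (X ∩ Y) x)) ≤ 0 := by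
    calc
      _ ≤ ∑ x, p x * (cylProb 𝒳 p X x * cylProb 𝒳 p Y x /
          (cylProb 𝒳 p (X ∪ Y) x * cylProb 𝒳 p (X ∩ Y) x) - 1) := by
        refine Finset.sum_le_sum fun x _ => ?_
        rcases (hp0 x).eq_or_lt with hx | hx
        · simp [← hx]
        · have hpos : ∀ A, 0 < cylProb 𝒳 p A x := fun A => hx.trans_le (le_cylProb hp0 A x)
          have h1 := hpos X
          have h2 := hpos Y
          have h3 := hpos (X ∪ Y)
          have h4 := hpos (X ∩ Y)
          refine mul_le_mul_of_nonneg_left ?_ hx.le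
          have := Real.log_le_sub_one_of_pos (div_pos (mul_pos h1 h2) (mul_pos h3 h4))
          rw [Real.log_div (by positivity) (by positivity), Real.log_mul h1.ne' h2.ne',
            Real.log_mul h3.ne' h4.ne'] at this
          linarith
      _ ≤ 0 := by
        simp only [mul_sub, mul_one, Finset.sum_sub_distrib, hp1]
        linarith [sum_mul_cylProb_div_le_one hp0 hp1 X Y]
  have heq : ent 𝒳 p (X ∪ Y) + ent 𝒳 p (X ∩ Y) - (ent 𝒳 p X + ent 𝒳 p Y) =
      (∑ x, p x * (Real.log (cylProb 𝒳 p X x) + Real.log (cylProb 𝒳 p Y x) -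
      Real.log (cylProb 𝒳 p (X ∪ Y) x) - Real.log (cylProb 𝒳 p (X ∩ Y) x))) / Real.log 2 := by
    simp only [ent_eq_neg_sum_cylProb, Real.logb, mul_add, mul_sub, Finset.sum_add_distrib,
      Finset.sum_sub_distrib, ← mul_div_assoc, ← Finset.sum_div]
    ring
  have := div_nonpos_of_nonpos_of_nonneg hle hlog.le
  linarith

lemma cmi_comm (A B S : Finset (Fin m)) : cmi 𝒳 p A B S = cmi 𝒳 p B A S := by
  rw [cmi, cmi, Finset.union_comm A B]
  ring

lemma cmi_empty_left (B S : Finset (Fin m)) : cmi 𝒳 p ∅ B S = 0 := by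
  simp [cmi]

lemma cmi_nonneg (hp0 : ∀ x, 0 ≤ p x) (hp1 : ∑ x, p x = 1) {A B S : Finset (Fin m)}
    (hAB : Disjoint A B) : 0 ≤ cmi 𝒳 p A B S := by
  have h := ent_submodular hp0 hp1 (A ∪ S) (B ∪ S)
  rw [← Finset.union_union_distrib_right, ← Finset.inter_union_distrib_right,
    Finset.disjoint_iff_inter_eq_empty.1 hAB, Finset.empty_union] at h
  rw [cmi]
  linarith

lemma cmi_mono_left (hp0 : ∀ x, 0 ≤ p x) (hp1 : ∑ x, p x = 1) {A A' B S : Finset (Fin m)}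
    (hA : A ⊆ A') (hAB : Disjoint A' B) : cmi 𝒳 p A B S ≤ cmi 𝒳 p A' B S := by
  have h := ent_submodular hp0 hp1 (A' ∪ S) (A ∪ B ∪ S)
  have h1 : (A' ∪ S) ∪ (A ∪ B ∪ S) = A' ∪ B ∪ S := by
    ext i
    have := @hA i
    simp only [Finset.mem_union]
    tauto
  have h2 : (A' ∪ S) ∩ (A ∪ B ∪ S) = A ∪ S := by
    ext i
    have := @hA i
    have : i ∈ A' → i ∉ B := fun hi => Finset.disjoint_left.1 hAB hi
    simp only [Finset.mem_union, Finset.mem_inter]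
    tauto
  rw [h1, h2] at h
  rw [cmi, cmi]
  linarith

lemma cmi_mono (hp0 : ∀ x, 0 ≤ p x) (hp1 : ∑ x, p x = 1) {A A' B B' S : Finset (Fin m)}
    (hA : A ⊆ A') (hB : B ⊆ B') (hAB : Disjoint A' B') :
    cmi 𝒳 p A B S ≤ cmi 𝒳 p A' B' S := by
  refine (cmi_mono_left hp0 hp1 hA (hAB.mono_right hB)).trans ?_
  rw [cmi_comm A' B, cmi_comm A' B']
  exact cmi_mono_left hp0 hp1 hB hAB.symm

end Entropy

section Graph

variable {V : Type*} {G : SimpleGraph V}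

lemma exists_adj_dist_lt (hG : G.Connected) {r v : V} (hv : v ≠ r) :
    ∃ u, G.Adj u v ∧ G.dist u r < G.dist v r := by
  obtain ⟨q, hq⟩ := hG.exists_walk_length_eq_dist v r
  cases q with
  | nil => exact absurd rfl hv
  | cons h q' =>
    refine ⟨_, h.symm, ?_⟩
    have := G.dist_le q'
    rw [SimpleGraph.Walk.length_cons] at hq
    omega

lemma reachable_deleteEdges_of_dist_le (hG : G.Connected) {r u v : V} (n : ℕ)
    (hn : n ≤ G.dist v r) (w : V) (hw : G.dist w r = n) (hwv : w ≠ v) :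
    (G.deleteEdges {s(u, v)}).Reachable w r := by
  induction n using Nat.strong_induction_on generalizing w with
  | _ n ih =>
    by_cases hwr : w = r
    · rw [hwr]
    · obtain ⟨w', hadj, hlt⟩ := exists_adj_dist_lt hG hwr
      have hw'v : w' ≠ v := by
        rintro rfl
        omega
      have h1 : (G.deleteEdges {s(u, v)}).Adj w w' := by
        rw [SimpleGraph.deleteEdges_adj]
        refine ⟨hadj.symm, ?_⟩
        simp only [Set.mem_singleton_iff, Sym2.eq_iff]
        tauto
      exact h1.reachable.trans (ih _ (hw ▸ hlt) (by omega) w' rfl hw'v)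

variable [Fintype V]

lemma mem_side_of_dist_le (hG : G.Connected) {r u v w : V}
    (huv : G.dist u r < G.dist v r) (hw : G.dist w r ≤ G.dist v r) (hwv : w ≠ v) :
    w ∈ side G u v := by
  have huv' : u ≠ v := by
    rintro rfl
    exact lt_irrefl _ huv
  simp only [side, Finset.mem_filter, Finset.mem_univ, true_and]
  exact (reachable_deleteEdges_of_dist_le hG _ hw w rfl hwv).trans
    (reachable_deleteEdges_of_dist_le hG _ huv.le u rfl huv').symm

lemma self_mem_side (u v : V) : u ∈ side G u v := by
  simp [side]

lemma notMem_side (hG : G.IsAcyclic) {u v : V} (huv : G.Adj u v) : v ∉ side G u v := by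
  have h := SimpleGraph.isAcyclic_iff_forall_adj_isBridge.1 hG huv
  rw [SimpleGraph.isBridge_iff] at h
  simpa [side, SimpleGraph.reachable_comm] using h

lemma mem_support_of_mem_side (hG : G.IsAcyclic) {i j b : V} (hij : G.Adj i j)
    (hb : b ∈ side G i j) (w : G.Walk j b) : i ∈ w.support := by
  by_contra hi
  have he : s(i, j) ∉ w.edges := fun h => hi (w.fst_mem_support_of_mem_edges h)
  refine notMem_side hG hij ?_
  simp only [side, Finset.mem_filter, Finset.mem_univ, true_and] at hb ⊢
  exact (w.toDeleteEdge _ he).reachable.trans hb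

end Graph

section Markov

variable {𝒳 : Fin m → Type} [∀ i, Fintype (𝒳 i)] {p : (∀ i, 𝒳 i) → ℝ}
  {G : SimpleGraph (Fin m)}

lemma GlobalMarkov.isMCT (hG : G.IsAcyclic) (h : GlobalMarkov 𝒳 G p) : IsMCT 𝒳 G p := by
  intro i j hij
  rcases ((side G i j).erase i).eq_empty_or_nonempty with he | hne
  · rw [he, cmi_comm, cmi_empty_left]
  · refine h _ _ _ (Finset.singleton_nonempty _) hne (Finset.singleton_nonempty _) ?_ ?_ ?_ ?_
    · rw [Finset.disjoint_singleton_left]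
      exact fun hj => notMem_side hG hij (Finset.mem_of_mem_erase hj)
    · simpa using hij.ne'
    · simp
    · intro a ha b hb w
      obtain rfl := Finset.mem_singleton.1 ha
      exact ⟨i, Finset.mem_singleton_self i,
        mem_support_of_mem_side hG hij (Finset.mem_of_mem_erase hb) w⟩

/-- In a Markov chain on a tree, adding `v` to a set of vertices on the far side of an edge `(u, v)`
that contains `u` raises the entropy by `H(X_v | X_u)`. -/
lemma IsMCT.ent_insert (hp0 : ∀ x, 0 ≤ p x) (hp1 : ∑ x, p x = 1) (hG : G.IsAcyclic)
    (h : IsMCT 𝒳 G p) {u v : Fin m} (huv : G.Adj u v) {D : Finset (Fin m)} (huD : u ∈ D)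
    (hD : D ⊆ side G u v) :
    ent 𝒳 p (insert v D) = ent 𝒳 p D + (ent 𝒳 p {v, u} - ent 𝒳 p {u}) := by
  have hv := notMem_side hG huv
  have hu := self_mem_side (G := G) u v
  have hloc : ent 𝒳 p {v, u} + ent 𝒳 p (side G u v) - ent 𝒳 p (insert v (side G u v)) -
      ent 𝒳 p {u} = 0 := by
    have := h u v huv
    rw [cmi, Finset.union_assoc, Finset.union_comm (Finset.erase _ _), ← Finset.insert_eq u,
      Finset.insert_erase hu] at this
    simpa [← Finset.insert_eq] using this
  have hvu : v ≠ u := huv.ne'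
  have h1 := ent_submodular hp0 hp1 {v, u} D
  have h2 := ent_submodular hp0 hp1 (insert v D) (side G u v)
  rw [show ({v, u} : Finset (Fin m)) ∪ D = insert v D by ext i; simp; grind,
    show ({v, u} : Finset (Fin m)) ∩ D = {u} by ext i; simp; grind] at h1
  rw [show insert v D ∪ side G u v = insert v (side G u v) by ext i; simp; grind,
    show insert v D ∩ side G u v = D by ext i; simp; grind] at h2
  linarith

/-- Conditioning additionally on a vertex hanging off `A ∪ S` keeps conditional independence. -/
lemma IsMCT.cmi_insert_right (hp0 : ∀ x, 0 ≤ p x) (hp1 : ∑ x, p x = 1) (hG : G.IsAcyclic)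
    (h : IsMCT 𝒳 G p) {u v : Fin m} (huv : G.Adj u v) {A B S : Finset (Fin m)}
    (hAB : Disjoint A B) (hvB : v ∉ B) (hu : u ∈ A ∪ S)
    (hU : A ∪ B ∪ S ⊆ side G u v) (h0 : cmi 𝒳 p A B S = 0) :
    cmi 𝒳 p A B (insert v S) = 0 := by
  refine le_antisymm ?_ (cmi_nonneg hp0 hp1 hAB)
  have hAS : A ∪ S ⊆ A ∪ B ∪ S := by grind
  have e1 := h.ent_insert hp0 hp1 hG huv hu (hAS.trans hU)
  have e2 := h.ent_insert hp0 hp1 hG huv (hAS hu) hU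
  have h1 := ent_submodular hp0 hp1 (insert v S) (B ∪ S)
  rw [show insert v S ∪ (B ∪ S) = insert v (B ∪ S) by ext i; simp; grind,
    show insert v S ∩ (B ∪ S) = S by ext i; simp; grind] at h1
  rw [cmi] at h0
  rw [cmi]
  simp only [Finset.union_insert]
  linarith

/-- Extending the left set by a vertex hanging off `A ∪ S` keeps conditional independence. -/
lemma IsMCT.cmi_insert_left (hp0 : ∀ x, 0 ≤ p x) (hp1 : ∑ x, p x = 1) (hG : G.IsAcyclic)
    (h : IsMCT 𝒳 G p) {u v : Fin m} (huv : G.Adj u v) {A B S : Finset (Fin m)}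
    (hu : u ∈ A ∪ S) (hU : A ∪ B ∪ S ⊆ side G u v) (h0 : cmi 𝒳 p A B S = 0) :
    cmi 𝒳 p (insert v A) B S = 0 := by
  have hAS : A ∪ S ⊆ A ∪ B ∪ S := by grind
  have e1 := h.ent_insert hp0 hp1 hG huv hu (hAS.trans hU)
  have e2 := h.ent_insert hp0 hp1 hG huv (hAS hu) hU
  rw [cmi] at h0
  rw [cmi]
  simp only [Finset.insert_union]
  linarith

lemma IsMCT.cmi_eq_zero_of_not_adj (hp0 : ∀ x, 0 ≤ p x) (hp1 : ∑ x, p x = 1) (hG : G.IsTree)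
    (h : IsMCT 𝒳 G p) (r : Fin m) (n : ℕ) (A B S : Finset (Fin m))
    (hn : (A ∪ B ∪ S).card = n) (hAB : Disjoint A B) (hAS : Disjoint A S) (hBS : Disjoint B S)
    (hadj : ∀ a ∈ A, ∀ b ∈ B, ¬ G.Adj a b)
    (hU : ∀ v ∈ A ∪ B ∪ S, ∀ w, G.dist w r < G.dist v r → w ∈ A ∪ B ∪ S) :
    cmi 𝒳 p A B S = 0 := by
  induction n generalizing A B S with
  | zero =>
    obtain rfl : A = ∅ := by
      rw [Finset.card_eq_zero] at hn
      simp_all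
    exact cmi_empty_left _ _
  | succ n ih =>
    have hne : (A ∪ B ∪ S).Nonempty := by
      rw [← Finset.card_pos]
      omega
    obtain ⟨v, hv, hmax⟩ := Finset.exists_max_image (A ∪ B ∪ S) (fun w => G.dist w r) hne
    rcases eq_or_ne v r with rfl | hvr
    · have hsub : ∀ w ∈ A ∪ B ∪ S, w = v := by
        intro w hw
        have := hmax w hw
        simpa [hG.connected.dist_eq_zero_iff] using this
      rcases A.eq_empty_or_nonempty with rfl | ⟨a, ha⟩
      · exact cmi_empty_left _ _
      · obtain rfl : B = ∅ := by
          rw [Finset.eq_empty_iff_forall_notMem]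
          intro b hb
          have ea := hsub a (by simp [ha])
          have eb := hsub b (by simp [hb])
          exact Finset.disjoint_left.1 hAB ha (by rwa [ea, ← eb])
        rw [cmi_comm, cmi_empty_left]
    · obtain ⟨u, huv, hlt⟩ := exists_adj_dist_lt hG.connected hvr
      have hu := hU v hv u hlt
      have huv' : u ≠ v := huv.ne
      have ac := hG.isAcyclic
      have hside : ∀ w ∈ A ∪ B ∪ S, w ≠ v → w ∈ side G u v := fun w hw hwv =>
        mem_side_of_dist_le hG.connected hlt (hmax w hw) hwv
      have hrec : ∀ A' B' S', A' ∪ B' ∪ S' = (A ∪ B ∪ S).erase v → A' ⊆ A → B' ⊆ B → S' ⊆ S →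
          A' ∪ B' ∪ S' ⊆ side G u v ∧ cmi 𝒳 p A' B' S' = 0 := by
        intro A' B' S' he hA hB hS
        refine ⟨fun w hw => ?_, ih A' B' S' ?_ (hAB.mono hA hB) (hAS.mono hA hS) (hBS.mono hB hS)
          (fun a ha b hb => hadj a (hA ha) b (hB hb)) ?_⟩
        · rw [he, Finset.mem_erase] at hw
          exact hside w hw.2 hw.1
        · rw [he, Finset.card_erase_of_mem hv, hn, Nat.add_sub_cancel]
        · intro x hx w hw
          rw [he, Finset.mem_erase] at hx ⊢
          refine ⟨?_, hU x hx.2 w hw⟩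
          rintro rfl
          exact absurd (hmax x hx.2) (not_le.2 hw)
      rw [Finset.disjoint_left] at hAB hAS hBS
      by_cases hvA : v ∈ A
      · obtain ⟨hs, h0⟩ := hrec (A.erase v) B S (by ext; simp; grind)
          (Finset.erase_subset _ _) subset_rfl subset_rfl
        have huB : u ∉ B := fun hb => hadj v hvA u hb huv.symm
        have := h.cmi_insert_left hp0 hp1 ac huv (by simp at hu ⊢; tauto) hs h0
        rwa [Finset.insert_erase hvA] at this
      by_cases hvB : v ∈ B
      · obtain ⟨hs, h0⟩ := hrec A (B.erase v) S (by ext; simp; grind)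
          subset_rfl (Finset.erase_subset _ _) subset_rfl
        have huA : u ∉ A := fun ha => hadj u ha v hvB huv
        rw [Finset.union_comm A] at hs
        rw [cmi_comm] at h0
        have := h.cmi_insert_left hp0 hp1 ac huv (by simp at hu ⊢; tauto) hs h0
        rwa [Finset.insert_erase hvB, cmi_comm] at this
      have hvS : v ∈ S := by
        simp only [Finset.mem_union] at hv
        tauto
      obtain ⟨hs, h0⟩ := hrec A B (S.erase v) (by ext; simp; grind)
          subset_rfl subset_rfl (Finset.erase_subset _ _)
      rw [← Finset.disjoint_left] at hAB
      by_cases huB : u ∈ B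
      · rw [Finset.union_comm A] at hs
        rw [cmi_comm] at h0
        have := h.cmi_insert_right hp0 hp1 ac huv hAB.symm hvA
          (by simp [huB]) hs h0
        rwa [Finset.insert_erase hvS, cmi_comm] at this
      · have := h.cmi_insert_right hp0 hp1 ac huv hAB hvB
          (by simp at hu ⊢; tauto) hs h0
        rwa [Finset.insert_erase hvS] at this

lemma IsMCT.globalMarkov (hp0 : ∀ x, 0 ≤ p x) (hp1 : ∑ x, p x = 1) (hG : G.IsTree)
    (h : IsMCT 𝒳 G p) : GlobalMarkov 𝒳 G p := by
  intro A B S ⟨r, _⟩ _ _ hAB hAS hBS hsep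
  let A' : Finset (Fin m) :=
    Finset.univ.filter fun v => ∃ a ∈ A, ∃ w : G.Walk a v, ∀ s ∈ S, s ∉ w.support
  let B' : Finset (Fin m) := Finset.univ \ (A' ∪ S)
  have hA' : ∀ v, v ∈ A' ↔ ∃ a ∈ A, ∃ w : G.Walk a v, ∀ s ∈ S, s ∉ w.support := by simp [A']
  have hB' : ∀ v, v ∈ B' ↔ v ∉ A' ∧ v ∉ S := by simp [B']
  have hAA' : A ⊆ A' := fun a ha => (hA' a).2 ⟨a, ha, .nil, fun s hs hsa => by
    rw [SimpleGraph.Walk.support_nil, List.mem_singleton] at hsa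
    exact Finset.disjoint_left.1 hAS ha (hsa ▸ hs)⟩
  have hBB' : B ⊆ B' := fun b hb => (hB' b).2 ⟨fun hb' => by
    obtain ⟨a, ha, w, hw⟩ := (hA' b).1 hb'
    obtain ⟨s, hs, hsw⟩ := hsep a ha b hb w
    exact hw s hs hsw, Finset.disjoint_left.1 hBS hb⟩
  have hA'B' : Disjoint A' B' := Finset.disjoint_left.2 fun v hv hv' => ((hB' v).1 hv').1 hv
  refine le_antisymm ((cmi_mono hp0 hp1 hAA' hBB' hA'B').trans_eq ?_) (cmi_nonneg hp0 hp1 hAB)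
  refine h.cmi_eq_zero_of_not_adj hp0 hp1 hG r _ A' B' S rfl hA'B' ?_ ?_ ?_ ?_
  · refine Finset.disjoint_left.2 fun v hv hvS => ?_
    obtain ⟨a, _, w, hw⟩ := (hA' v).1 hv
    exact hw v hvS w.end_mem_support
  · exact Finset.disjoint_left.2 fun v hv => ((hB' v).1 hv).2
  · intro v hv b hb hvb
    obtain ⟨a, ha, w, hw⟩ := (hA' v).1 hv
    obtain ⟨hbA, hbS⟩ := (hB' b).1 hb
    refine hbA ((hA' b).2 ⟨a, ha, w.concat hvb, fun s hs hsw => ?_⟩)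
    rw [SimpleGraph.Walk.support_concat] at hsw
    simp only [List.mem_append, List.mem_singleton] at hsw
    rcases hsw with hsw | rfl
    · exact hw s hs hsw
    · exact hbS hs
  · intro v _ w _
    simp only [Finset.mem_union, hB']
    tauto

end Markov

/-- Random variables on the vertices of a tree form a Markov chain on the
tree iff they have the global Markov property; no strict positivity of the joint pmf is
assumed. -/
theorem isMCT_iff_globalMarkov
    {m : ℕ} (hm : 2 ≤ m) (𝒳 : Fin m → Type) [∀ i, Fintype (𝒳 i)]
    (p : (∀ i, 𝒳 i) → ℝ) (hp0 : ∀ x, 0 ≤ p x) (hp1 : ∑ x, p x = 1)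
    (G : SimpleGraph (Fin m)) (hG : G.IsTree) :
    IsMCT 𝒳 G p ↔ GlobalMarkov 𝒳 G p :=
  ⟨fun h => h.globalMarkov hp0 hp1 hG, fun h => h.isMCT hG.isAcyclic⟩

end MCT
end
end
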